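/- arXiv:1803.04287 — 4 statements merged into one kernel-verified Lean document; each statement's English description precedes it below -/
import Mathlib

section
/- Fix an integer l ≥ 2. For every d ∈ ℤ^{ℤ/lℤ} there exists a unique integer n such that d and n·δ_l lie in the same W_l^aff-orbit. -/
/-- The generator `s_j` of the affine Weyl group of type `Ã_{l-1}` acting (non-linearly)
on `ℤ^{ℤ/lℤ}`: `(s_j d)_i = d_i` for `i ≠ j` and
`(s_j d)_j = [j=0] + d_{j+1} + d_{j-1} - d_j`. -/
def sZ (l : ℕ) (j : ZMod l) (d : ZMod l → ℤ) : ZMod l → ℤ :=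
  fun i => if i = j then (if j = 0 then 1 else 0) + d (j + 1) + d (j - 1) - d j else d i

/-- `d` and `d'` lie in the same `W_l^aff`-orbit: `d' = s_{j₁}(s_{j₂}(⋯ s_{j_r}(d)⋯))` for some
finite (possibly empty) sequence of indices. -/
def SameOrbit (l : ℕ) (d d' : ZMod l → ℤ) : Prop :=
  ∃ js : List (ZMod l), d' = js.foldr (sZ l) d

/-- The sum of the squares of the consecutive differences of `d`. -/
def diffEnergy (l : ℕ) [NeZero l] (d : ZMod l → ℤ) : ℤ :=
  ∑ i, (d (i + 1) - d i) ^ 2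

/-- The generators of the affine Weyl group preserve `diffEnergy l d - 2 * d 0`. -/
theorem diffEnergy_sZ (l : ℕ) [NeZero l] (hl : 2 ≤ l) (j : ZMod l) (d : ZMod l → ℤ) :
    diffEnergy l (sZ l j d) - 2 * sZ l j d 0 = diffEnergy l d - 2 * d 0 := by
  have : Fact (1 < l) := ⟨hl⟩
  have h10 : (1 : ZMod l) ≠ 0 := one_ne_zero
  set t : ℤ := (if j = 0 then 1 else 0) + d (j + 1) + d (j - 1) - 2 * d j with ht
  have hs (i : ZMod l) : sZ l j d i = d i + if i = j then t else 0 := by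
    unfold sZ
    by_cases h : i = j
    · subst h
      simp only [if_true, ht]
      ring
    · simp [h]
  have hterm (i : ZMod l) : (sZ l j d (i + 1) - sZ l j d i) ^ 2 = (d (i + 1) - d i) ^ 2 +
      (if i = j - 1 then 2 * (d j - d (j - 1)) * t + t ^ 2 else 0) +
      (if i = j then t ^ 2 - 2 * (d (j + 1) - d j) * t else 0) := by
    rw [hs, hs]
    by_cases h : i = j
    · subst h
      have h1 : i + 1 ≠ i := by simp
      have h2 : i ≠ i - 1 := by
        intro h
        exact h10 (by linear_combination h)
      simp only [if_neg h1, if_neg h2, if_true]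
      ring
    · by_cases h' : i = j - 1
      · subst h'
        simp only [sub_add_cancel, if_true, if_neg h]
        ring
      · have h1 : i + 1 ≠ j := fun h2 => h' (eq_sub_of_add_eq h2)
        simp [h, h', h1]
  have hE : diffEnergy l (sZ l j d) =
      diffEnergy l d + 2 * t * (t + (d j - d (j - 1)) - (d (j + 1) - d j)) := by
    unfold diffEnergy
    simp only [hterm, Finset.sum_add_distrib, Finset.sum_ite_eq', Finset.mem_univ, if_true]
    ring
  rw [hE, hs]
  by_cases h : j = 0
  · subst h
    simp only [if_true] at ht ⊢
    linear_combination 2 * t * ht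
  · simp only [if_neg h, if_neg (Ne.symm h)] at ht ⊢
    linear_combination 2 * t * ht

theorem SameOrbit.diffEnergy_eq {l : ℕ} [NeZero l] (hl : 2 ≤ l) {d d' : ZMod l → ℤ}
    (h : SameOrbit l d d') : diffEnergy l d' - 2 * d' 0 = diffEnergy l d - 2 * d 0 := by
  obtain ⟨js, rfl⟩ := h
  induction js with
  | nil => rfl
  | cons j js ih => rw [List.foldr_cons, diffEnergy_sZ l hl, ih]

theorem SameOrbit.sZ_right {l : ℕ} {d d' : ZMod l → ℤ} (h : SameOrbit l d d') (j : ZMod l) :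
    SameOrbit l d (sZ l j d') := by
  obtain ⟨js, rfl⟩ := h
  exact ⟨j :: js, rfl⟩

theorem ZMod.sum_range_natCast {M : Type*} [AddCommMonoid M] (l : ℕ) [NeZero l]
    (f : ZMod l → M) : ∑ k ∈ Finset.range l, f k = ∑ i, f i := by
  refine Finset.sum_bij (fun k _ => (k : ZMod l)) (by simp) ?_ ?_ (by simp)
  · intro a ha b hb h
    rw [ZMod.natCast_eq_natCast_iff'] at h
    rwa [Nat.mod_eq_of_lt (Finset.mem_range.1 ha), Nat.mod_eq_of_lt (Finset.mem_range.1 hb)] at h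
  · intro b _
    exact ⟨b.val, Finset.mem_range.2 b.val_lt, by simp⟩

theorem sub_diffEnergy_sub_le (l : ℕ) [NeZero l] (d : ZMod l → ℤ) (i : ZMod l) :
    2 * d 0 - diffEnergy l d - l ≤ 2 * d i := by
  have key (n : ℕ) : 2 * d 0 - ∑ k ∈ Finset.range n, ((d ((k : ZMod l) + 1) - d k) ^ 2 + 1) ≤
      2 * d n := by
    induction n with
    | zero => simp
    | succ n ih =>
      rw [Finset.sum_range_succ, Nat.cast_succ]
      nlinarith [sq_nonneg (d ((n : ZMod l) + 1) - d n + 1)]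
  have hmono : ∑ k ∈ Finset.range i.val, ((d ((k : ZMod l) + 1) - d k) ^ 2 + 1) ≤
      ∑ k ∈ Finset.range l, ((d ((k : ZMod l) + 1) - d k) ^ 2 + 1) :=
    Finset.sum_le_sum_of_subset_of_nonneg (Finset.range_mono i.val_lt.le)
      (fun _ _ _ => by positivity)
  have hsum : ∑ k ∈ Finset.range l, ((d ((k : ZMod l) + 1) - d k) ^ 2 + 1) =
      diffEnergy l d + l := by
    rw [ZMod.sum_range_natCast l (fun i => (d (i + 1) - d i) ^ 2 + 1), Finset.sum_add_distrib]
    simp [diffEnergy, ZMod.card]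
  have := key i.val
  rw [ZMod.natCast_zmod_val] at this
  linarith

/-- If no generator decreases `d`, then `d` is constant. -/
theorem eq_const_of_le_sZ {l : ℕ} [NeZero l] {d : ZMod l → ℤ}
    (h : ∀ j, d j ≤ sZ l j d j) : d = fun _ => d 0 := by
  have hpos : 0 < l := Nat.pos_of_ne_zero (NeZero.ne l)
  set c : ℕ → ℤ := fun n => d ((n + 1 : ℕ) : ZMod l) - d (n : ZMod l) with hc
  have hstep (n : ℕ) (hn : n + 1 < l) : c n ≤ c (n + 1) := by
    have hne : ((n + 1 : ℕ) : ZMod l) ≠ 0 := by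
      rw [Ne, ZMod.natCast_eq_zero_iff]
      exact Nat.not_dvd_of_pos_of_lt n.succ_pos hn
    have := h ((n + 1 : ℕ) : ZMod l)
    simp only [sZ, if_true, if_neg hne] at this
    simp only [hc]
    push_cast at this ⊢
    rw [add_sub_cancel_right] at this
    linarith
  have hmono (m n : ℕ) (hmn : m ≤ n) (hn : n < l) : c m ≤ c n := by
    induction n, hmn using Nat.le_induction with
    | base => exact le_rfl
    | succ n _ ih => exact (ih (by omega)).trans (hstep n hn)
  have hlast : c (l - 1) ≤ c 0 + 1 := by
    have := h 0
    simp only [sZ, if_true] at this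
    simp only [hc, Nat.sub_add_cancel hpos, Nat.cast_sub (Nat.one_le_of_lt hpos)]
    simp only [CharP.cast_eq_zero, Nat.cast_one, Nat.cast_zero, zero_add] at this ⊢
    linarith
  have hend : d ((l : ℕ) : ZMod l) = d 0 := by simp
  have hnat (n : ℕ) (hn : n ≤ l) : d (n : ZMod l) = d 0 := by
    rcases le_or_gt 0 (c 0) with h0 | h0
    · have hle (a b : ℕ) (hab : a ≤ b) (hb : b ≤ l) : d (a : ZMod l) ≤ d (b : ZMod l) := by
        induction b, hab using Nat.le_induction with
        | base => exact le_rfl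
        | succ b _ ih =>
          have h1 := hmono 0 b b.zero_le hb
          have h2 := ih (by omega)
          simp only [hc] at h0 h1
          linarith
      have h1 := hle 0 n n.zero_le hn
      have h2 := hle n l hn le_rfl
      rw [Nat.cast_zero] at h1
      linarith
    · have hle (a b : ℕ) (hab : a ≤ b) (hb : b ≤ l) : d (b : ZMod l) ≤ d (a : ZMod l) := by
        induction b, hab using Nat.le_induction with
        | base => exact le_rfl
        | succ b _ ih =>
          have h1 := hmono b (l - 1) (by omega) (by omega)
          have h2 := ih (by omega)
          have h3 : c b ≤ 0 := by omega
          simp only [hc] at h3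
          linarith
      have h1 := hle 0 n n.zero_le hn
      have h2 := hle n l hn le_rfl
      rw [Nat.cast_zero] at h1
      linarith
  funext i
  have := hnat i.val i.val_lt.le
  rwa [ZMod.natCast_zmod_val] at this

theorem exists_sameOrbit_minimal_sum (l : ℕ) [NeZero l] (hl : 2 ≤ l) (d : ZMod l → ℤ) :
    ∃ e, SameOrbit l d e ∧ ∀ e', SameOrbit l d e' → ∑ i, e i ≤ ∑ i, e' i := by
  have hbdd : ∃ b : ℤ, ∀ z, (∃ e, SameOrbit l d e ∧ ∑ i, e i = z) → b ≤ z := by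
    refine ⟨∑ _i : ZMod l, -|2 * d 0 - diffEnergy l d - l|, ?_⟩
    rintro _ ⟨e, he, rfl⟩
    refine Finset.sum_le_sum fun i _ => ?_
    have h1 := sub_diffEnergy_sub_le l e i
    have h2 := he.diffEnergy_eq hl
    have h3 := neg_abs_le (2 * d 0 - diffEnergy l d - l)
    have h4 := abs_nonneg (2 * d 0 - diffEnergy l d - l)
    linarith
  obtain ⟨_, ⟨e, he, rfl⟩, hmin⟩ := Int.exists_least_of_bdd hbdd ⟨_, d, ⟨[], rfl⟩, rfl⟩
  exact ⟨e, he, fun e' he' => hmin _ ⟨e', he', rfl⟩⟩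

/-- For every `d ∈ ℤ^{ℤ/lℤ}` there is a unique integer `n` such that `d` and the constant
function `n` (i.e. `n·δ_l`) lie in the same `W_l^aff`-orbit. -/
theorem exists_unique_int_sameOrbit_const (l : ℕ) (hl : 2 ≤ l) (d : ZMod l → ℤ) :
    ∃! n : ℤ, SameOrbit l d (fun _ => n) := by
  have : NeZero l := ⟨by omega⟩
  obtain ⟨e, he, hmin⟩ := exists_sameOrbit_minimal_sum l hl d
  have hconst : e = fun _ => e 0 := by
    refine eq_const_of_le_sZ fun j => ?_
    have h := hmin _ (he.sZ_right j)
    rw [← Finset.add_sum_erase _ e (Finset.mem_univ j),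
      ← Finset.add_sum_erase _ (sZ l j e) (Finset.mem_univ j)] at h
    have hrest : ∑ i ∈ Finset.univ.erase j, sZ l j e i = ∑ i ∈ Finset.univ.erase j, e i :=
      Finset.sum_congr rfl fun i hi => if_neg (Finset.ne_of_mem_erase hi)
    linarith
  refine ⟨e 0, hconst ▸ he, fun n hn => ?_⟩
  have h1 := hn.diffEnergy_eq hl
  have h2 := (hconst ▸ he : SameOrbit l d fun _ => e 0).diffEnergy_eq hl
  simp only [diffEnergy, sub_self] at h1 h2
  linarith
end

section
/- Fix an integer l ≥ 2 and let d ∈ ℤ^{ℤ/lℤ}. Then the following are equivalent: (a) d = Res_l(λ) for some l-core λ; (b) d lies in the same W_l^aff-orbit as the zero function 0 ∈ ℤ^{ℤ/lℤ}. -/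
/-- The `l`-residue of a box `(r, s)` of a Young diagram (0-based row `r`, column `s`):
the class of `s - r` in `ℤ/lℤ`. -/
def boxRes (l : ℕ) (c : ℕ × ℕ) : ZMod l := (c.2 : ZMod l) - (c.1 : ZMod l)

/-- `Res_l(λ) ∈ ℤ^{ℤ/lℤ}`: the function counting the boxes of `λ` with each `l`-residue. -/
def Res (l : ℕ) (lam : YoungDiagram) : ZMod l → ℤ :=
  fun i => ((lam.cells.filter fun c => boxRes l c = i).card : ℤ)

/-- `λ` is an `l`-core: there is no Young diagram `μ ≤ λ` obtained from `λ` by removing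
exactly `l` boxes having pairwise distinct `l`-residues. -/
def IsCore (l : ℕ) (lam : YoungDiagram) : Prop :=
  ¬ ∃ mu : YoungDiagram, mu ≤ lam ∧ (lam.cells \ mu.cells).card = l ∧
      Set.InjOn (boxRes l) ↑(lam.cells \ mu.cells)

/-- The content `s - r` of a box in row `r` and column `s`. -/
def content (x : ℕ × ℕ) : ℤ := (x.2 : ℤ) - x.1

/-- The number of boxes of a Young diagram on each diagonal. -/
def diagLen (lam : YoungDiagram) (c : ℤ) : ℤ := ((lam.cells.filter fun x => content x = c).card : ℤ)

/-- The occupation number of site `c` in the Maya diagram attached to the diagonal lengths `D`. -/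
def bead (D : ℤ → ℤ) (c : ℤ) : ℤ := D c - D (c + 1) + if c < 0 then 1 else 0

/-- The functions `ℤ → ℤ` which are the diagonal lengths of a Young diagram. -/
structure IsProfile (D : ℤ → ℤ) : Prop where
  finite_support : D.support.Finite
  bead_eq (c : ℤ) : bead D c = 0 ∨ bead D c = 1

/-- The sum of `D` over each residue class modulo `l`. -/
noncomputable def resSum (l : ℕ) (D : ℤ → ℤ) (i : ZMod l) : ℤ :=
  ∑ᶠ c : ℤ, if (c : ZMod l) = i then D c else 0

/-- The action of `s_j` on diagonal lengths: it switches all addable and removable boxes of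
residue `j`. -/
def swapProfile (l : ℕ) (j : ZMod l) (D : ℤ → ℤ) (c : ℤ) : ℤ :=
  if (c : ZMod l) = j then (if c = 0 then 1 else 0) + D (c + 1) + D (c - 1) - D c else D c

/-- Beads can be pushed down by `l` only onto occupied sites. -/
def IsFlush (l : ℕ) (D : ℤ → ℤ) : Prop := ∀ p, bead D p = 1 → bead D (p - l) = 1

namespace IsProfile

variable {D : ℤ → ℤ}

theorem exists_bound (h : IsProfile D) : ∃ N : ℕ, ∀ c : ℤ, (N : ℤ) ≤ |c| → D c = 0 := by
  obtain ⟨M, hM⟩ := (h.finite_support.image fun c => |c|).bddAbove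
  refine ⟨(M + 1).toNat, fun c hc => ?_⟩
  by_contra hne
  have := hM ⟨c, hne, rfl⟩
  simp only at this
  omega

theorem nonneg (h : IsProfile D) (c : ℤ) : 0 ≤ D c := by
  obtain ⟨N, hN⟩ := h.exists_bound
  rcases le_total 0 c with hc | hc
  · have key : ∀ k : ℕ, D (c + k) ≤ D c := by
      intro k
      induction k with
      | zero => simp
      | succ k ih =>
        have := h.bead_eq (c + k)
        rw [bead, if_neg (by omega)] at this
        push_cast
        rw [← add_assoc]
        omega
    have h1 := key N
    rwa [hN _ (by rw [abs_of_nonneg (by omega)]; omega)] at h1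
  · have key : ∀ k : ℕ, D (c - k) ≤ D c := by
      intro k
      induction k with
      | zero => simp
      | succ k ih =>
        have := h.bead_eq (c - k - 1)
        rw [bead, if_pos (by omega), sub_add_cancel] at this
        push_cast
        rw [← sub_sub]
        omega
    have h1 := key N
    rwa [hN _ (by rw [abs_of_nonpos (by omega)]; omega)] at h1

/-- A nonzero profile has a removable box. -/
theorem exists_removable (h : IsProfile D) (hD : D ≠ 0) :
    ∃ c, bead D c = 1 ∧ bead D (c - 1) = 0 := by
  obtain ⟨N, hN⟩ := h.exists_bound
  have hne : h.finite_support.toFinset.Nonempty := by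
    rw [Set.Finite.toFinset_nonempty]
    exact Function.support_nonempty_iff.mpr hD
  obtain ⟨c, hc, hmax⟩ := h.finite_support.toFinset.exists_max_image id hne
  rw [Set.Finite.mem_toFinset, Function.mem_support] at hc
  have hc1 : D (c + 1) = 0 := by
    by_contra hne'
    have := hmax (c + 1) (by simpa using hne')
    simp at this
  have hpos := h.nonneg c
  have hbc : bead D c = 1 := by
    have := h.bead_eq c
    unfold bead at this ⊢
    split_ifs at this ⊢ <;> omega
  by_contra hno
  push Not at hno
  have hone : ∀ k : ℕ, bead D (c - k) = 1 := by
    intro k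
    induction k with
    | zero => simpa using hbc
    | succ k ih =>
      have h1 := hno _ ih
      have h2 := h.bead_eq (c - k - 1)
      push_cast
      rw [← sub_sub]
      tauto
  have hmono : ∀ k : ℕ, D c ≤ D (c - k) := by
    intro k
    induction k with
    | zero => simp
    | succ k ih =>
      have h1 := hone (k + 1)
      push_cast at h1 ⊢
      rw [← sub_sub] at h1 ⊢
      rw [bead, sub_add_cancel] at h1
      split_ifs at h1 <;> omega
  have h1 := hmono (N + c.natAbs)
  have h2 := hN (c - (N + c.natAbs : ℕ)) (le_abs.mpr (Or.inr (by omega)))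
  omega

end IsProfile

section Swap

variable {l : ℕ}

theorem swapProfile_ne_succ (hl : 2 ≤ l) {j : ZMod l} {c : ℤ} (hc : (c : ZMod l) = j) :
    ((c + 1 : ℤ) : ZMod l) ≠ j ∧ ((c - 1 : ℤ) : ZMod l) ≠ j := by
  have : Fact (1 < l) := ⟨hl⟩
  subst hc
  constructor <;> push_cast <;> simp

theorem bead_swapProfile (hl : 2 ≤ l) (j : ZMod l) (D : ℤ → ℤ) (c : ℤ) :
    bead (swapProfile l j D) c =
      if (c : ZMod l) = j then bead D (c - 1)
      else if ((c + 1 : ℤ) : ZMod l) = j then bead D (c + 1) else bead D c := by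
  by_cases h1 : (c : ZMod l) = j
  · have h2 := (swapProfile_ne_succ hl h1).1
    simp only [bead, swapProfile, if_pos h1, if_neg h2, sub_add_cancel]
    split_ifs <;> omega
  · by_cases h2 : ((c + 1 : ℤ) : ZMod l) = j
    · simp only [bead, swapProfile, if_pos h2, if_neg h1, add_sub_cancel_right]
      split_ifs <;> omega
    · simp only [bead, swapProfile, if_neg h1, if_neg h2]

theorem IsProfile.swapProfile (hl : 2 ≤ l) {D : ℤ → ℤ} (h : IsProfile D) (j : ZMod l) :
    IsProfile (_root_.swapProfile l j D) := by
  refine ⟨?_, fun c => ?_⟩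
  · obtain ⟨N, hN⟩ := h.exists_bound
    refine (Set.finite_Icc (-(N + 1 : ℤ)) (N + 1)).subset fun c hc => ?_
    by_contra hout
    refine hc ?_
    rw [Set.mem_Icc, ← abs_le, not_le] at hout
    have h0 := hN c (by omega)
    have h1 := hN (c + 1) (by grind)
    have h2 := hN (c - 1) (by grind)
    have h3 : c ≠ 0 := by grind
    simp [_root_.swapProfile, h0, h1, h2, h3]
  · rw [bead_swapProfile hl]
    split_ifs <;> exact h.bead_eq _

theorem IsFlush.swapProfile (hl : 2 ≤ l) {D : ℤ → ℤ} (h : IsFlush l D) (j : ZMod l) :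
    IsFlush l (_root_.swapProfile l j D) := by
  intro p hp
  rw [bead_swapProfile hl] at hp ⊢
  have e1 : ((p - l : ℤ) : ZMod l) = p := by simp
  have e2 : ((p - l + 1 : ℤ) : ZMod l) = ((p + 1 : ℤ) : ZMod l) := by simp
  rw [e1, e2]
  split_ifs at hp ⊢
  · have := h _ hp
    rwa [show p - l - 1 = p - 1 - (l : ℤ) by ring]
  · have := h _ hp
    rwa [show p - l + 1 = p + 1 - (l : ℤ) by ring]
  · exact h _ hp

theorem resSum_swapProfile {D : ℤ → ℤ} (h : D.support.Finite) (j : ZMod l) :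
    resSum l (swapProfile l j D) = sZ l j (resSum l D) := by
  funext i
  by_cases hi : i = j
  · subst hi
    have hfin : ∀ k : ZMod l, (Function.support fun c : ℤ =>
        if (c : ZMod l) = k then D c else 0).Finite := fun k =>
      h.subset fun c hc => by
        simp only [Function.mem_support, ne_eq, ite_eq_right_iff, not_forall] at hc
        exact hc.2
    have f1 := (hfin (i + 1)).preimage (f := Equiv.addRight (1 : ℤ)) (Equiv.injective _).injOn
    have f2 := (hfin (i - 1)).preimage (f := Equiv.subRight (1 : ℤ)) (Equiv.injective _).injOn
    have f0 : (Function.support fun c : ℤ => if c = 0 then if (i = 0) then (1 : ℤ) else 0 else 0).Finite :=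
      (Set.finite_singleton (0 : ℤ)).subset fun c hc => by
        simp only [Function.mem_support, ne_eq, ite_eq_right_iff, not_forall] at hc
        exact hc.1
    have s0 : ∑ᶠ c : ℤ, (if c = 0 then if (i = 0) then (1 : ℤ) else 0 else 0)
        = if i = 0 then 1 else 0 := by
      rw [finsum_eq_single _ (0 : ℤ) (by intro x hx; simp [hx])]
      simp
    have s1 := finsum_comp_equiv (Equiv.addRight (1 : ℤ))
      (f := fun c : ℤ => if (c : ZMod l) = i + 1 then D c else 0)
    have s2 := finsum_comp_equiv (Equiv.subRight (1 : ℤ))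
      (f := fun c : ℤ => if (c : ZMod l) = i - 1 then D c else 0)
    simp only [sZ, if_true]
    unfold resSum
    rw [← s0, ← s1, ← s2, ← finsum_add_distrib f0 f1, ← finsum_add_distrib _ f2,
      ← finsum_sub_distrib _ (hfin i)]
    · refine finsum_congr fun c => ?_
      by_cases hc : (c : ZMod l) = i
      · by_cases h0 : c = 0
        · subst h0
          have : i = 0 := by simpa using hc.symm
          subst this
          simp [swapProfile]
        · simp [swapProfile, hc, h0]
      · have : ¬ (c = 0 ∧ i = 0) := by
          rintro ⟨rfl, rfl⟩
          simp at hc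
        simp [hc]
        tauto
    · exact ((f0.union f1).union f2).subset ((Function.support_add _ _).trans
        (Set.union_subset_union_left _ (Function.support_add _ _)))
    · exact (f0.union f1).subset (Function.support_add _ _)
  · simp only [sZ, if_neg hi, resSum]
    refine finsum_congr fun c => ?_
    by_cases hc : (c : ZMod l) = i
    · have : (c : ZMod l) ≠ j := hc ▸ hi
      simp [swapProfile, hc, hi]
    · simp [hc]

theorem sZ_sZ (hl : 2 ≤ l) (j : ZMod l) (d : ZMod l → ℤ) : sZ l j (sZ l j d) = d := by
  have : Fact (1 < l) := ⟨hl⟩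
  funext i
  by_cases hi : i = j
  · subst hi
    simp [sZ]
  · simp [sZ, hi]

theorem sZ_sub_one (j : ZMod l) (d : ZMod l → ℤ) : sZ l j (d - 1) = sZ l j d - 1 := by
  funext i
  by_cases hi : i = j
  · subst hi
    simp [sZ]
    ring
  · simp [sZ, hi]

theorem foldr_sZ_sub_one (js : List (ZMod l)) (d : ZMod l → ℤ) :
    js.foldr (sZ l) (d - 1) = js.foldr (sZ l) d - 1 := by
  induction js with
  | nil => rfl
  | cons j js ih => rw [List.foldr_cons, ih, sZ_sub_one, List.foldr_cons]

theorem exists_resSum_eq_foldr_iff (hl : 2 ≤ l) (js : List (ZMod l)) (d : ZMod l → ℤ) :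
    (∃ D, IsProfile D ∧ resSum l D = js.foldr (sZ l) d) ↔ ∃ D, IsProfile D ∧ resSum l D = d := by
  have step : ∀ (j : ZMod l) (e : ZMod l → ℤ), (∃ D, IsProfile D ∧ resSum l D = e) →
      ∃ D, IsProfile D ∧ resSum l D = sZ l j e := by
    rintro j e ⟨D, hD, rfl⟩
    exact ⟨_, hD.swapProfile hl j, resSum_swapProfile hD.finite_support j⟩
  induction js with
  | nil => rfl
  | cons j js ih =>
    refine Iff.trans ?_ ih
    rw [List.foldr_cons]
    exact ⟨fun h => by simpa only [sZ_sZ hl] using step j _ h, step j _⟩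

theorem IsFlush.sub_mul {D : ℤ → ℤ} (h : IsFlush l D) {p : ℤ} (hp : bead D p = 1) (k : ℕ) :
    bead D (p - l * k) = 1 := by
  induction k with
  | zero => simpa using hp
  | succ k ih =>
    have := h _ ih
    push_cast
    rwa [show p - l * ((k : ℤ) + 1) = p - l * k - l by ring]

theorem IsFlush.swapProfile_apply_le {D : ℤ → ℤ} (hD : IsProfile D) (h : IsFlush l D)
    {c : ℤ} (h1 : bead D c = 1) (h0 : bead D (c - 1) = 0) (x : ℤ) :
    _root_.swapProfile l c D x ≤ D x := by
  unfold _root_.swapProfile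
  by_cases hx : (x : ZMod l) = c
  · have key : bead D (x - 1) ≤ bead D x := by
      by_contra hlt
      have ha := hD.bead_eq (x - 1)
      have hb := hD.bead_eq x
      have ha' : bead D (x - 1) = 1 := by omega
      have hb' : bead D x = 0 := by omega
      obtain ⟨k, hk⟩ := (ZMod.intCast_eq_intCast_iff_dvd_sub x c l).mp hx
      rcases le_total 0 k with hk0 | hk0
      · have := h.sub_mul h1 k.toNat
        rw [Int.toNat_of_nonneg hk0, ← hk, sub_sub_cancel] at this
        omega
      · have := h.sub_mul ha' (-k).toNat
        rw [Int.toNat_of_nonneg (by omega), mul_neg, ← hk,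
          show x - 1 - -(c - x) = c - 1 by ring] at this
        omega
    unfold bead at key
    rw [sub_add_cancel] at key
    rw [if_pos hx]
    split_ifs at key ⊢ <;> omega
  · rw [if_neg hx]

theorem swapProfile_lt {D : ℤ → ℤ} {c : ℤ} (h1 : bead D c = 1) (h0 : bead D (c - 1) = 0) :
    swapProfile l c D c < D c := by
  unfold bead at h1 h0
  rw [sub_add_cancel] at h0
  rw [swapProfile, if_pos rfl]
  split_ifs at h1 h0 ⊢ <;> omega

theorem IsFlush.sameOrbit_zero (hl : 2 ≤ l) {D : ℤ → ℤ} (hD : IsProfile D) (h : IsFlush l D) :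
    SameOrbit l (resSum l D) fun _ => 0 := by
  induction hn : (∑ᶠ c, D c).toNat using Nat.strong_induction_on generalizing D with
  | _ n ih =>
  by_cases hz : D = 0
  · subst hz
    exact ⟨[], by funext i; simp [resSum]⟩
  · obtain ⟨c, h1, h0⟩ := hD.exists_removable hz
    have hD' := hD.swapProfile hl (c : ZMod l)
    have hlt : ∑ᶠ x, _root_.swapProfile l c D x < ∑ᶠ x, D x := by
      rw [finsum_eq_sum_of_support_subset (s := hD.finite_support.toFinset ∪
          hD'.finite_support.toFinset) _ (by simp), finsum_eq_sum_of_support_subset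
          (s := hD.finite_support.toFinset ∪ hD'.finite_support.toFinset) _ (by simp)]
      refine Finset.sum_lt_sum (fun x _ => h.swapProfile_apply_le hD h1 h0 x)
        ⟨c, ?_, swapProfile_lt h1 h0⟩
      rw [Finset.mem_union, Set.Finite.mem_toFinset, Set.Finite.mem_toFinset,
        Function.mem_support, Function.mem_support]
      have := swapProfile_lt (l := l) h1 h0
      omega
    have hnn : 0 ≤ ∑ᶠ x, _root_.swapProfile l c D x := finsum_nonneg hD'.nonneg
    obtain ⟨js, hjs⟩ := ih _ (by omega) hD' (h.swapProfile hl c) rfl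
    refine ⟨js ++ [(c : ZMod l)], ?_⟩
    rw [hjs, List.foldr_append, resSum_swapProfile hD.finite_support]
    rfl

end Swap

section Diagram

/-- The box at depth `k` on the diagonal of content `c`. -/
def diagBox (c : ℤ) (k : ℕ) : ℕ × ℕ := (k + (-c).toNat, k + c.toNat)

theorem content_diagBox (c : ℤ) (k : ℕ) : content (diagBox c k) = c := by
  simp only [content, diagBox]
  omega

theorem diagBox_content_min (x : ℕ × ℕ) : diagBox (content x) (min x.1 x.2) = x := by
  ext <;> simp only [content, diagBox] <;> omega

theorem diagBox_min (c : ℤ) (k : ℕ) : min (diagBox c k).1 (diagBox c k).2 = k := by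
  simp only [diagBox]
  omega

theorem card_filter_content {s : Finset (ℕ × ℕ)} {c : ℤ} {n : ℕ}
    (h : ∀ k, diagBox c k ∈ s ↔ k < n) : (s.filter fun x => content x = c).card = n := by
  have himg : (s.filter fun x => content x = c) = (Finset.range n).image (diagBox c) := by
    ext x
    simp only [Finset.mem_filter, Finset.mem_image, Finset.mem_range]
    constructor
    · rintro ⟨hx, rfl⟩
      exact ⟨min x.1 x.2, (h _).mp (by rwa [diagBox_content_min]), diagBox_content_min x⟩
    · rintro ⟨k, hk, rfl⟩
      exact ⟨(h k).mpr hk, content_diagBox c k⟩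
  rw [himg, Finset.card_image_of_injective, Finset.card_range]
  intro a b hab
  simpa [diagBox] using hab

theorem diagBox_mem_iff (lam : YoungDiagram) (c : ℤ) (k : ℕ) :
    diagBox c k ∈ lam ↔ (k : ℤ) < diagLen lam c := by
  have hex : ∃ n, diagBox c n ∉ lam := by
    obtain ⟨n, hn⟩ := Infinite.exists_notMem_finset (lam.cells.image fun x => min x.1 x.2)
    refine ⟨n, fun hmem => hn (Finset.mem_image.mpr ⟨_, hmem, diagBox_min c n⟩)⟩
  classical
  have hn : ∀ k, diagBox c k ∈ lam ↔ k < Nat.find hex := by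
    intro k
    rw [Nat.lt_find_iff]
    refine ⟨fun h m hm => not_not.mpr ?_, fun h => not_not.mp (h k le_rfl)⟩
    exact lam.up_left_mem (by omega) (by omega) h
  rw [diagLen, card_filter_content hn, hn]
  norm_cast

theorem mem_iff_lt_diagLen (lam : YoungDiagram) (x : ℕ × ℕ) :
    x ∈ lam ↔ ((min x.1 x.2 : ℕ) : ℤ) < diagLen lam (content x) := by
  rw [← diagBox_mem_iff, diagBox_content_min]

theorem isProfile_diagLen (lam : YoungDiagram) : IsProfile (diagLen lam) := by
  constructor
  · refine (lam.cells.image content).finite_toSet.subset fun c hc => ?_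
    simp only [Function.mem_support, diagLen, ne_eq, Nat.cast_eq_zero, Finset.card_eq_zero,
      ← Finset.nonempty_iff_ne_empty] at hc
    obtain ⟨x, hx⟩ := hc
    rw [Finset.mem_filter] at hx
    exact Finset.mem_coe.mpr (Finset.mem_image.mpr ⟨x, hx⟩)
  · intro c
    have hmono : ∀ (a b : ℤ) (k m : ℕ), (diagBox a k).1 ≤ (diagBox b m).1 →
        (diagBox a k).2 ≤ (diagBox b m).2 → (m : ℤ) < diagLen lam b → (k : ℤ) < diagLen lam a := by
      intro a b k m h1 h2 h
      rw [← diagBox_mem_iff] at h ⊢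
      exact lam.up_left_mem h1 h2 h
    obtain ⟨n, hn⟩ : ∃ n : ℕ, diagLen lam c = n := ⟨_, rfl⟩
    obtain ⟨m, hm⟩ : ∃ m : ℕ, diagLen lam (c + 1) = m := ⟨_, rfl⟩
    simp only [diagBox] at hmono
    rw [bead, hn, hm]
    split_ifs with hc
    · have h1 := hmono (c + 1) c (n - 1) (n - 1) (by omega) (by omega)
      have h2 := hmono c (c + 1) n (n + 1) (by omega) (by omega)
      omega
    · have h1 := hmono c (c + 1) (m - 1) (m - 1) (by omega) (by omega)
      have h2 := hmono (c + 1) c m (m + 1) (by omega) (by omega)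
      omega

theorem IsProfile.exists_diagLen_eq {D : ℤ → ℤ} (h : IsProfile D) :
    ∃ lam : YoungDiagram, diagLen lam = D := by
  have hfin : {x : ℕ × ℕ | ((min x.1 x.2 : ℕ) : ℤ) < D (content x)}.Finite := by
    refine (h.finite_support.biUnion (t := fun c =>
      Set.Iic ((D c).toNat + c.natAbs, (D c).toNat + c.natAbs)) fun c _ => Set.finite_Iic _).subset
      fun x hx => ?_
    rw [Set.mem_ofPred_eq] at hx
    rw [Set.mem_iUnion₂]
    refine ⟨content x, by rw [Function.mem_support]; omega, ?_⟩
    have : content x = x.2 - x.1 := rfl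
    constructor <;> simp only <;> omega
  have hstep : ∀ (r s : ℕ), ((min (r + 1) s : ℕ) : ℤ) < D (content (r + 1, s)) →
      ((min r s : ℕ) : ℤ) < D (content (r, s)) := by
    intro r s hrs
    have hb := h.bead_eq (content (r + 1, s))
    have e : content (r, s) = content (r + 1, s) + 1 := by simp [content]; ring
    rw [e]
    unfold bead at hb
    have : content (r + 1, s) = s - (r + 1 : ℤ) := by simp [content]
    split_ifs at hb <;> omega
  have hstep' : ∀ (r s : ℕ), ((min r (s + 1) : ℕ) : ℤ) < D (content (r, s + 1)) →
      ((min r s : ℕ) : ℤ) < D (content (r, s)) := by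
    intro r s hrs
    have hb := h.bead_eq (content (r, s))
    have e : content (r, s + 1) = content (r, s) + 1 := by simp [content]; ring
    rw [e] at hrs
    unfold bead at hb
    have : content (r, s) = s - (r : ℤ) := by simp [content]
    split_ifs at hb <;> omega
  refine ⟨⟨hfin.toFinset, ?_⟩, ?_⟩
  · rintro ⟨r, s⟩ ⟨r', s'⟩ ⟨hr, hs⟩ hmem
    simp only [Set.Finite.coe_toFinset, Set.mem_ofPred_eq] at hmem ⊢
    simp only at hr hs
    obtain ⟨a, rfl⟩ := Nat.exists_eq_add_of_le hr
    obtain ⟨b, rfl⟩ := Nat.exists_eq_add_of_le hs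
    have h1 : ((min r' (s' + b) : ℕ) : ℤ) < D (content (r', s' + b)) := by
      clear hr
      induction a with
      | zero => exact hmem
      | succ a ih => exact ih (hstep _ _ hmem)
    clear hmem hs
    induction b with
    | zero => exact h1
    | succ b ih => exact ih (hstep' _ _ h1)
  · funext c
    have hc := h.nonneg c
    rw [diagLen, card_filter_content (n := (D c).toNat), Int.toNat_of_nonneg hc]
    intro k
    rw [Set.Finite.mem_toFinset, Set.mem_ofPred_eq, diagBox_min, content_diagBox]
    omega

theorem boxRes_eq_content (l : ℕ) (x : ℕ × ℕ) : boxRes l x = (content x : ZMod l) := by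
  simp [boxRes, content]

theorem Res_eq_resSum (l : ℕ) (lam : YoungDiagram) : Res l lam = resSum l (diagLen lam) := by
  funext i
  rw [resSum, finsum_eq_sum_of_support_subset (s := lam.cells.image content)]
  · rw [Res, Finset.card_eq_sum_card_fiberwise (f := content) (t := lam.cells.image content)]
    · push_cast
      refine Finset.sum_congr rfl fun c _ => ?_
      rw [Finset.filter_filter]
      split_ifs with hc
      · rw [diagLen]
        congr 2
        refine Finset.filter_congr fun x _ => ?_
        rw [boxRes_eq_content]
        constructor
        · exact And.right
        · rintro rfl
          exact ⟨hc, rfl⟩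
      · rw [Nat.cast_eq_zero, Finset.card_eq_zero, Finset.filter_eq_empty_iff]
        rintro x _ ⟨h1, rfl⟩
        exact hc (by rwa [boxRes_eq_content] at h1)
    · intro x hx
      exact Finset.mem_coe.mpr (Finset.mem_image_of_mem _ (Finset.mem_filter.mp hx).1)
  · intro c hc
    by_contra hne
    refine hc ?_
    have : diagLen lam c = 0 := by
      rw [diagLen, Nat.cast_eq_zero, Finset.card_eq_zero, Finset.filter_eq_empty_iff]
      rintro x hx rfl
      exact hne (Finset.mem_coe.mpr (Finset.mem_image_of_mem _ hx))
    simp [this]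

/-- Pushing a bead down from `p` to `p - l` removes a rim hook. -/
theorem IsCore.isFlush {l : ℕ} (hl : 2 ≤ l) {lam : YoungDiagram} (h : IsCore l lam) :
    IsFlush l (diagLen lam) := by
  intro p hp
  by_contra hq
  have hD := isProfile_diagLen lam
  have hq0 := (hD.bead_eq (p - l)).resolve_right hq
  set D := diagLen lam with hDdef
  let E : ℤ → ℤ := fun c => if p - l < c ∧ c ≤ p then D c - 1 else D c
  have hE : IsProfile E := by
    constructor
    · refine (hD.finite_support.union (Set.finite_Ioc (p - l) p)).subset fun c hc => ?_
      by_cases hc' : p - l < c ∧ c ≤ p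
      · exact Or.inr hc'
      · exact Or.inl (by simpa [E, hc'] using hc)
    · intro c
      have hb := hD.bead_eq c
      by_cases h1 : c = p
      · subst h1
        left
        simp only [bead, E] at hp ⊢
        rw [if_pos (by omega), if_neg (by omega)]
        omega
      · by_cases h2 : c = p - l
        · subst h2
          right
          simp only [bead, E] at hq0 ⊢
          rw [if_neg (by omega), if_pos (by omega)]
          omega
        · simp only [bead, E] at hb ⊢
          by_cases h3 : p - l < c ∧ c ≤ p
          · rw [if_pos h3, if_pos (by omega)]
            omega
          · rw [if_neg h3, if_neg (by omega)]
            exact hb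
  obtain ⟨mu, hmu⟩ := hE.exists_diagLen_eq
  have hmem : ∀ x, x ∈ lam.cells \ mu.cells ↔
      (p - l < content x ∧ content x ≤ p) ∧ ((min x.1 x.2 : ℕ) : ℤ) = D (content x) - 1 := by
    intro x
    rw [Finset.mem_sdiff, YoungDiagram.mem_cells, YoungDiagram.mem_cells, mem_iff_lt_diagLen,
      mem_iff_lt_diagLen, hmu, ← hDdef]
    simp only [E]
    split_ifs <;> omega
  have hinj : Set.InjOn content ↑(lam.cells \ mu.cells) := by
    intro x hx y hy hxy
    rw [Finset.mem_coe, hmem] at hx hy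
    have : min x.1 x.2 = min y.1 y.2 := by
      have h1 := hx.2
      rw [hxy, ← hy.2] at h1
      exact_mod_cast h1
    rw [← diagBox_content_min x, ← diagBox_content_min y, hxy, this]
  have himg : (lam.cells \ mu.cells).image content = Finset.Ioc (p - l) p := by
    ext c
    rw [Finset.mem_image, Finset.mem_Ioc]
    constructor
    · rintro ⟨x, hx, rfl⟩
      exact ((hmem x).mp hx).1
    · intro hc
      have hpos := hE.nonneg c
      simp only [E, if_pos hc] at hpos
      refine ⟨diagBox c (D c - 1).toNat, (hmem _).mpr ?_, content_diagBox _ _⟩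
      rw [content_diagBox, diagBox_min]
      omega
  refine h ⟨mu, ?_, ?_, ?_⟩
  · rw [← YoungDiagram.cells_subset_iff]
    intro x hx
    rw [YoungDiagram.mem_cells, mem_iff_lt_diagLen] at hx ⊢
    rw [hmu] at hx
    rw [← hDdef]
    simp only [E] at hx
    split_ifs at hx <;> omega
  · rw [← Finset.card_image_of_injOn hinj, himg, Int.card_Ioc]
    omega
  · intro x hx y hy hxy
    refine hinj hx hy ?_
    rw [Finset.mem_coe, hmem] at hx hy
    rw [boxRes_eq_content, boxRes_eq_content, ZMod.intCast_eq_intCast_iff_dvd_sub] at hxy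
    have := Int.eq_zero_of_abs_lt_dvd hxy (by rw [abs_lt]; omega)
    omega

theorem Res_eq_sub_one {l : ℕ} [NeZero l] {lam mu : YoungDiagram} (hle : mu ≤ lam)
    (hcard : (lam.cells \ mu.cells).card = l)
    (hinj : Set.InjOn (boxRes l) ↑(lam.cells \ mu.cells)) : Res l mu = Res l lam - 1 := by
  funext i
  have hsub : mu.cells ⊆ lam.cells := YoungDiagram.cells_subset_iff.mpr hle
  have huniv : (lam.cells \ mu.cells).image (boxRes l) = Finset.univ := by
    rw [← Finset.card_eq_iff_eq_univ, Finset.card_image_of_injOn hinj, hcard, ZMod.card]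
  obtain ⟨x, hx, hxi⟩ := Finset.mem_image.mp (huniv ▸ Finset.mem_univ i)
  have hone : ((lam.cells \ mu.cells).filter fun c => boxRes l c = i) = {x} := by
    ext y
    rw [Finset.mem_filter, Finset.mem_singleton]
    constructor
    · rintro ⟨hy, hyi⟩
      exact hinj hy hx (hyi.trans hxi.symm)
    · rintro rfl
      exact ⟨hx, hxi⟩
  have hsum : (lam.cells.filter fun c => boxRes l c = i).card =
      ((lam.cells \ mu.cells).filter fun c => boxRes l c = i).card +
        (mu.cells.filter fun c => boxRes l c = i).card := by
    rw [← Finset.card_union_of_disjoint, ← Finset.filter_union, Finset.sdiff_union_of_subset hsub]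
    exact Finset.disjoint_filter_filter Finset.sdiff_disjoint
  rw [hone, Finset.card_singleton] at hsum
  simp only [Res, Pi.sub_apply, Pi.one_apply, hsum]
  push_cast
  ring

end Diagram

/-- `d = Res_l(λ)` for some `l`-core `λ` iff `d` lies in the same `W_l^aff`-orbit as `0`. -/
theorem res_core_iff_sameOrbit_zero (l : ℕ) (hl : 2 ≤ l) (d : ZMod l → ℤ) :
    (∃ lam : YoungDiagram, IsCore l lam ∧ Res l lam = d) ↔
      SameOrbit l d (fun _ => 0) := by
  have : NeZero l := ⟨by omega⟩
  constructor
  · rintro ⟨lam, hcore, rfl⟩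
    rw [Res_eq_resSum]
    exact (hcore.isFlush hl).sameOrbit_zero hl (isProfile_diagLen lam)
  · rintro ⟨js, hjs⟩
    obtain ⟨D, hD, hDd⟩ := (exists_resSum_eq_foldr_iff hl js d).mp
      ⟨0, ⟨by simp, fun c => by unfold bead; split_ifs <;> simp⟩, by
        rw [← hjs]
        funext i
        simp [resSum]⟩
    obtain ⟨lam, rfl⟩ := hD.exists_diagLen_eq
    rw [← Res_eq_resSum] at hDd
    refine ⟨lam, ?_, hDd⟩
    rintro ⟨mu, hle, hcard, hinj⟩
    have hmu := Res_eq_sub_one hle hcard hinj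
    rw [hDd, Res_eq_resSum] at hmu
    obtain ⟨E, hE, hE1⟩ := (exists_resSum_eq_foldr_iff hl js (d - 1)).mpr
      ⟨_, isProfile_diagLen mu, hmu⟩
    rw [foldr_sZ_sub_one, ← hjs] at hE1
    have h0 : 0 ≤ resSum l E 0 := finsum_nonneg fun c => by
      split_ifs
      exacts [hE.nonneg c, le_rfl]
    rw [hE1] at h0
    simp at h0
end

section
/- Let l ≥ 1, k ≥ 1, m = kl, n ≥ 0, and θ ∈ ℂ^{ℤ/lℤ}; define θ[k] ∈ ℂ^{ℤ/mℤ} by θ[k]_j = θ_i whenever j ≡ i (mod l). Let d : ℤ/mℤ → ℕ satisfy Σ_{j∈ℤ/mℤ, j ≡ i (mod l)} d_j = n for every i ∈ ℤ/lℤ, and let (X, Y) ∈ Y_{θ[k]}(d). For each i ∈ ℤ/lℤ, identify ℂ^n with the direct sum ⊕_{j ≡ i (mod l)} ℂ^{d_j}, and define X′_i : ⊕_{j′ ≡ i+1 (mod l)} ℂ^{d_{j′}} → ⊕_{j ≡ i (mod l)} ℂ^{d_j} as the map sending the summand ℂ^{d_{j+1}} to the summand ℂ^{d_j} via X_j for each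 j ≡ i (mod l), and Y′_i : ⊕_{j ≡ i (mod l)} ℂ^{d_j} → ⊕_{j′ ≡ i+1 (mod l)} ℂ^{d_{j′}} as the map sending ℂ^{d_j} to ℂ^{d_{j+1}} via Y_j. Then (X′, Y′) ∈ Y_θ(n·δ_l); explicitly, X′_i Y′_i − Y′_{i−1} X′_{i−1} = θ_i·Id_n for every i ≠ 0 in ℤ/lℤ, and the n × n matrix X′_0 Y′_0 − Y′_{−1} X′_{−1} − θ_0·Id_n has rank at most 1 and trace −n·Σ_{i∈ℤ/lℤ} θ_i. -/
open Matrix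

/-- Membership in `Y_θ(d)` for a representation `(X, Y)` of the doubled cyclic quiver with
`m` vertices: at every vertex `j+1 ≠ 0` the moment-map relation
`X_{j+1} Y_{j+1} - Y_j X_j = θ_{j+1}·Id` holds, while at the vertex `j+1 = 0` the matrix
`X_0 Y_0 - Y_{-1} X_{-1} - θ_0·Id` has rank at most `1` and trace `-Σ_j θ_j d_j`. -/
def MemY (m : ℕ) [NeZero m] (θ : ZMod m → ℂ) (d : ZMod m → ℕ)
    (X : ∀ j : ZMod m, Matrix (Fin (d j)) (Fin (d (j + 1))) ℂ)
    (Y : ∀ j : ZMod m, Matrix (Fin (d (j + 1))) (Fin (d j)) ℂ) : Prop :=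
  ∀ j : ZMod m,
    (j + 1 ≠ 0 →
      X (j + 1) * Y (j + 1) - Y j * X j
        = θ (j + 1) • (1 : Matrix (Fin (d (j + 1))) (Fin (d (j + 1))) ℂ)) ∧
    (j + 1 = 0 →
      (X (j + 1) * Y (j + 1) - Y j * X j - θ (j + 1) • 1).rank ≤ 1 ∧
      Matrix.trace (X (j + 1) * Y (j + 1) - Y j * X j - θ (j + 1) • 1)
        = -∑ j' : ZMod m, θ j' * (d j' : ℂ))

/-- The index set realizing the identification `ℂ^n ≃ ⊕_{j ≡ i (mod l)} ℂ^{d_j}`: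
pairs of a vertex `j ∈ ℤ/mℤ` with `j ≡ i (mod l)` and a basis index of `ℂ^{d_j}`. -/
abbrev Fib (l m : ℕ) (d : ZMod m → ℕ) (i : ZMod l) : Type :=
  (j : {j : ZMod m // ((j.val : ZMod l) = i)}) × Fin (d j.1)

/-- The block matrix `X'_i : ⊕_{j' ≡ i+1} ℂ^{d_{j'}} → ⊕_{j ≡ i} ℂ^{d_j}`, sending the
summand `ℂ^{d_{j+1}}` to the summand `ℂ^{d_j}` via `X_j`. -/
def XBlock (l m : ℕ) (d : ZMod m → ℕ)
    (X : ∀ j : ZMod m, Matrix (Fin (d j)) (Fin (d (j + 1))) ℂ) (i : ZMod l) :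
    Matrix (Fib l m d i) (Fib l m d (i + 1)) ℂ :=
  fun p q =>
    if h : q.1.1 = p.1.1 + 1 then X p.1.1 p.2 (Fin.cast (congrArg d h) q.2) else 0

/-- The block matrix `Y'_i : ⊕_{j ≡ i} ℂ^{d_j} → ⊕_{j' ≡ i+1} ℂ^{d_{j'}}`, sending the
summand `ℂ^{d_j}` to the summand `ℂ^{d_{j+1}}` via `Y_j`. -/
def YBlock (l m : ℕ) (d : ZMod m → ℕ)
    (Y : ∀ j : ZMod m, Matrix (Fin (d (j + 1))) (Fin (d j)) ℂ) (i : ZMod l) :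
    Matrix (Fib l m d (i + 1)) (Fib l m d i) ℂ :=
  fun q p =>
    if h : q.1.1 = p.1.1 + 1 then Y p.1.1 (Fin.cast (congrArg d h) q.2) p.2 else 0

theorem ZMod.natCast_val_add_one {l m : ℕ} [NeZero m] (hlm : l ∣ m) (j : ZMod m) :
    (((j + 1).val : ℕ) : ZMod l) = (j.val : ZMod l) + 1 := by
  rw [ZMod.natCast_val, ZMod.natCast_val, ZMod.cast_add hlm, ZMod.cast_one hlm]

section Blocks

variable {l m : ℕ} [NeZero m] {d : ZMod m → ℕ}
  (X : ∀ j : ZMod m, Matrix (Fin (d j)) (Fin (d (j + 1))) ℂ)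
  (Y : ∀ j : ZMod m, Matrix (Fin (d (j + 1))) (Fin (d j)) ℂ)

theorem XBlock_mul_YBlock_apply_of_ne (i : ZMod l) {p q : Fib l m d i} (h : p.1 ≠ q.1) :
    (XBlock l m d X i * YBlock l m d Y i) p q = 0 := by
  rw [Matrix.mul_apply]
  refine Finset.sum_eq_zero fun r _ => ?_
  by_cases hp : r.1.1 = p.1.1 + 1
  · have hq : r.1.1 ≠ q.1.1 + 1 := fun hq =>
      h (Subtype.ext (add_right_cancel (hp.symm.trans hq)))
    simp [YBlock, hq]
  · simp [XBlock, hp]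

theorem YBlock_mul_XBlock_apply_of_ne (i : ZMod l) {p q : Fib l m d (i + 1)} (h : p.1 ≠ q.1) :
    (YBlock l m d Y i * XBlock l m d X i) p q = 0 := by
  rw [Matrix.mul_apply]
  refine Finset.sum_eq_zero fun r _ => ?_
  by_cases hp : p.1.1 = r.1.1 + 1
  · have hq : q.1.1 ≠ r.1.1 + 1 := fun hq => h (Subtype.ext (hp.trans hq.symm))
    simp [XBlock, hq]
  · simp [YBlock, hp]

theorem XBlock_mul_YBlock_apply_same (hlm : l ∣ m) (i : ZMod l)
    (j : {j : ZMod m // (j.val : ZMod l) = i}) (a b : Fin (d j.1)) :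
    (XBlock l m d X i * YBlock l m d Y i) ⟨j, a⟩ ⟨j, b⟩ = (X j.1 * Y j.1) a b := by
  rw [Matrix.mul_apply, Matrix.mul_apply, Fintype.sum_sigma,
    Fintype.sum_eq_single
      (⟨j.1 + 1, by rw [ZMod.natCast_val_add_one hlm, j.2]⟩ :
        {j : ZMod m // (j.val : ZMod l) = i + 1})]
  · simp [XBlock, YBlock]
  · intro r hr
    have hr' : r.1 ≠ j.1 + 1 := fun h => hr (Subtype.ext h)
    simp [XBlock, hr']

theorem YBlock_mul_XBlock_apply_same (i : ZMod l) (j : ZMod m)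
    (hj : (j.val : ZMod l) = i) (hj' : ((j + 1).val : ZMod l) = i + 1)
    (a b : Fin (d (j + 1))) :
    (YBlock l m d Y i * XBlock l m d X i) ⟨⟨j + 1, hj'⟩, a⟩ ⟨⟨j + 1, hj'⟩, b⟩
      = (Y j * X j) a b := by
  rw [Matrix.mul_apply, Matrix.mul_apply, Fintype.sum_sigma,
    Fintype.sum_eq_single (⟨j, hj⟩ : {j : ZMod m // (j.val : ZMod l) = i})]
  · simp [XBlock, YBlock]
  · intro r hr
    have hr' : j ≠ r.1 := fun h => hr (Subtype.ext h.symm)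
    simp [YBlock, hr']

end Blocks

/-- A matrix indexed by a sigma type and supported on the single diagonal block `s` has the rank
bound and the trace of that block. -/
theorem Matrix.rank_le_and_trace_eq_of_single_block {ι : Type*} [Fintype ι] [DecidableEq ι]
    {κ : ι → Type*} [∀ i, Fintype (κ i)] [∀ i, DecidableEq (κ i)]
    (M : Matrix (Σ i, κ i) (Σ i, κ i) ℂ) (s : ι) (N : Matrix (κ s) (κ s) ℂ)
    (hN : ∀ a b, M ⟨s, a⟩ ⟨s, b⟩ = N a b) (hM : ∀ p q, p.1 ≠ s ∨ q.1 ≠ s → M p q = 0) :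
    M.rank ≤ N.rank ∧ M.trace = N.trace := by
  constructor
  · have hfac : M = (1 : Matrix (Σ i, κ i) (Σ i, κ i) ℂ).submatrix id (Sigma.mk s) * N *
        (1 : Matrix (Σ i, κ i) (Σ i, κ i) ℂ).submatrix (Sigma.mk s) id := by
      ext ⟨i, a⟩ ⟨j, b⟩
      by_cases hi : i = s
      · by_cases hj : j = s
        · subst hi
          subst hj
          simp [Matrix.mul_apply, Matrix.one_apply, hN]
        · rw [hM _ _ (Or.inr hj), Matrix.mul_apply]
          simp [Ne.symm hj]
      · rw [hM _ _ (Or.inl hi), Matrix.mul_apply]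
        simp [Matrix.mul_apply, Matrix.one_apply, hi]
    rw [hfac]
    exact (Matrix.rank_mul_le_left _ _).trans (Matrix.rank_mul_le_right _ _)
  · rw [Matrix.trace, Fintype.sum_sigma, Fintype.sum_eq_single s]
    · simp [Matrix.trace, hN]
    · intro i hi
      exact Finset.sum_eq_zero fun a _ => hM _ _ (Or.inl hi)

/-- If `(X, Y) ∈ Y_{θ[k]}(d)` for a dimension vector `d` on `ℤ/mℤ` (`m = kl`) whose fiber
sums over `j ≡ i (mod l)` all equal `n`, then the block matrices `(X', Y')` lie in
`Y_θ(n·δ_l)`: explicitly, `X'_{i} Y'_{i} - Y'_{i-1} X'_{i-1} = θ_{i}·Id` at every vertex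
`i ≠ 0` of `ℤ/lℤ`, and at the vertex `0` the matrix
`X'_0 Y'_0 - Y'_{-1} X'_{-1} - θ_0·Id` has rank at most `1` and trace `-n·Σ_i θ_i`. -/
theorem blocks_mem_Y (l k : ℕ) [NeZero l] [NeZero k] (n : ℕ)
    (θ : ZMod l → ℂ) (d : ZMod (k * l) → ℕ)
    (hd : ∀ i : ZMod l,
      ∑ j ∈ Finset.univ.filter (fun j : ZMod (k * l) => ((j.val : ZMod l) = i)), d j = n)
    (X : ∀ j : ZMod (k * l), Matrix (Fin (d j)) (Fin (d (j + 1))) ℂ)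
    (Y : ∀ j : ZMod (k * l), Matrix (Fin (d (j + 1))) (Fin (d j)) ℂ)
    (hXY : MemY (k * l) (fun j => θ ((j.val : ZMod l))) d X Y) :
    ∀ i : ZMod l,
      (i + 1 ≠ 0 →
        XBlock l (k * l) d X (i + 1) * YBlock l (k * l) d Y (i + 1)
            - YBlock l (k * l) d Y i * XBlock l (k * l) d X i
          = θ (i + 1) •
              (1 : Matrix (Fib l (k * l) d (i + 1)) (Fib l (k * l) d (i + 1)) ℂ)) ∧
      (i + 1 = 0 →
        (XBlock l (k * l) d X (i + 1) * YBlock l (k * l) d Y (i + 1)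
            - YBlock l (k * l) d Y i * XBlock l (k * l) d X i - θ (i + 1) • 1).rank ≤ 1 ∧
        Matrix.trace (XBlock l (k * l) d X (i + 1) * YBlock l (k * l) d Y (i + 1)
            - YBlock l (k * l) d Y i * XBlock l (k * l) d X i - θ (i + 1) • 1)
          = -(n : ℂ) * ∑ i' : ZMod l, θ i') := by
  have hlm : l ∣ k * l := Dvd.intro_left k rfl
  intro i
  have hval : ∀ j : ZMod (k * l), ((j + 1).val : ZMod l) = i + 1 → (j.val : ZMod l) = i :=
    fun j hj => add_right_cancel ((ZMod.natCast_val_add_one hlm j).symm.trans hj)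
  have hoff : ∀ p q : Fib l (k * l) d (i + 1), p.1 ≠ q.1 →
      (XBlock l (k * l) d X (i + 1) * YBlock l (k * l) d Y (i + 1)
        - YBlock l (k * l) d Y i * XBlock l (k * l) d X i
        - θ (i + 1) • (1 : Matrix (Fib l (k * l) d (i + 1)) (Fib l (k * l) d (i + 1)) ℂ)) p q
          = 0 := by
    intro p q h
    have hpq : p ≠ q := fun e => h (congrArg Sigma.fst e)
    rw [Matrix.sub_apply, Matrix.sub_apply, XBlock_mul_YBlock_apply_of_ne X Y _ h,
      YBlock_mul_XBlock_apply_of_ne X Y _ h, Matrix.smul_apply, Matrix.one_apply_ne hpq]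
    simp
  have hdiag : ∀ (j : ZMod (k * l)) (hj : ((j + 1).val : ZMod l) = i + 1)
      (a b : Fin (d (j + 1))),
      (XBlock l (k * l) d X (i + 1) * YBlock l (k * l) d Y (i + 1)
        - YBlock l (k * l) d Y i * XBlock l (k * l) d X i
        - θ (i + 1) • (1 : Matrix (Fib l (k * l) d (i + 1)) (Fib l (k * l) d (i + 1)) ℂ))
          ⟨⟨j + 1, hj⟩, a⟩ ⟨⟨j + 1, hj⟩, b⟩
        = (X (j + 1) * Y (j + 1) - Y j * X j
            - θ ((j + 1).val : ZMod l) •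
              (1 : Matrix (Fin (d (j + 1))) (Fin (d (j + 1))) ℂ)) a b := by
    intro j hj a b
    simp only [Matrix.sub_apply, Matrix.smul_apply]
    rw [XBlock_mul_YBlock_apply_same X Y hlm, YBlock_mul_XBlock_apply_same X Y i j (hval j hj) hj,
      hj]
    simp [Matrix.one_apply]
  have hzero : ∀ (j : ZMod (k * l)) (hj : ((j + 1).val : ZMod l) = i + 1), j + 1 ≠ 0 →
      ∀ a b : Fin (d (j + 1)),
      (XBlock l (k * l) d X (i + 1) * YBlock l (k * l) d Y (i + 1)
        - YBlock l (k * l) d Y i * XBlock l (k * l) d X i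
        - θ (i + 1) • (1 : Matrix (Fib l (k * l) d (i + 1)) (Fib l (k * l) d (i + 1)) ℂ))
          ⟨⟨j + 1, hj⟩, a⟩ ⟨⟨j + 1, hj⟩, b⟩ = 0 := by
    intro j hj hne a b
    rw [hdiag j hj, (hXY j).1 hne, sub_self, Matrix.zero_apply]
  refine ⟨fun hi => sub_eq_zero.mp ?_, fun hi => ?_⟩
  · ext ⟨⟨j, hj⟩, a⟩ ⟨⟨j', hj'⟩, b⟩
    rw [Matrix.zero_apply]
    by_cases hjj : j = j'
    · subst hjj
      obtain ⟨j, rfl⟩ : ∃ j₀, j = j₀ + 1 := ⟨j - 1, (sub_add_cancel j 1).symm⟩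
      refine hzero j hj (fun h0 => hi ?_) a b
      rw [← hj, h0, ZMod.val_zero, Nat.cast_zero]
    · exact hoff _ _ fun h => hjj (congrArg Subtype.val h)
  · obtain ⟨j₀, h0⟩ : ∃ j₀ : ZMod (k * l), j₀ + 1 = 0 := ⟨-1, neg_add_cancel 1⟩
    have hj₀ : ((j₀ + 1).val : ZMod l) = i + 1 := by
      rw [h0, hi, ZMod.val_zero, Nat.cast_zero]
    obtain ⟨hrank, htrace⟩ := (hXY j₀).2 h0
    obtain ⟨hr, ht⟩ := Matrix.rank_le_and_trace_eq_of_single_block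
      (XBlock l (k * l) d X (i + 1) * YBlock l (k * l) d Y (i + 1)
        - YBlock l (k * l) d Y i * XBlock l (k * l) d X i
        - θ (i + 1) • (1 : Matrix (Fib l (k * l) d (i + 1)) (Fib l (k * l) d (i + 1)) ℂ))
      ⟨j₀ + 1, hj₀⟩ _ (hdiag j₀ hj₀) (by
        rintro ⟨⟨j, hj⟩, a⟩ ⟨⟨j', hj'⟩, b⟩ hs
        by_cases hjj : j = j'
        · subst hjj
          obtain ⟨j, rfl⟩ : ∃ j₁, j = j₁ + 1 := ⟨j - 1, (sub_add_cancel j 1).symm⟩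
          refine hzero j hj (fun h => ?_) a b
          exact (or_self_iff.mp hs) (Subtype.ext (h.trans h0.symm))
        · exact hoff _ _ fun h => hjj (congrArg Subtype.val h))
    refine ⟨hr.trans hrank, ht.trans (htrace.trans ?_)⟩
    rw [neg_mul, Finset.mul_sum,
      ← Finset.sum_fiberwise Finset.univ (fun j : ZMod (k * l) => (j.val : ZMod l))]
    congr 1
    refine Finset.sum_congr rfl fun i' _ => ?_
    rw [← hd i', Nat.cast_sum, Finset.sum_mul]
    refine Finset.sum_congr rfl fun j hj => ?_
    beta_reduce
    rw [(Finset.mem_filter.mp hj).2, mul_comm]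
end

section
/- Let ω ∈ ℂ be a primitive third root of unity, let s = [[ω, 0], [ω², 1]] and t = [[1, −ω²], [0, ω]] be elements of GL₂(ℂ), and let W = ⟨s, t⟩ be the subgroup of GL₂(ℂ) generated by s and t (the complex reflection group of type G₄). If σ ∈ GL₂(ℂ) has finite order and normalizes W (i.e. σWσ⁻¹ = W), then σ ∈ ℂ^×·W, i.e. there exist a root of unity c ∈ ℂ^× and an element w ∈ W such that σ = c·w. -/
/-- Membership in the quaternion subgroup of `G₄`, written as explicit matrices. -/
def IsG4Quaternion (ω : ℂ) (q : Matrix (Fin 2) (Fin 2) ℂ) : Prop :=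
  ∃ ε : ℂ, (ε = 1 ∨ ε = -1) ∧
    (q = ε • !![1, 0; 0, 1] ∨ q = ε • !![-ω, -ω ^ 2; -ω ^ 2, ω] ∨
      q = ε • !![0, -1; 1, 0] ∨ q = ε • !![-ω ^ 2, ω; ω, ω ^ 2])

theorem cube_root_sq {ω : ℂ} (hω : IsPrimitiveRoot ω 3) : ω ^ 2 = -ω - 1 := by
  have h := hω.geom_sum_eq_zero (by norm_num)
  simp only [Finset.sum_range_succ, Finset.sum_range_zero] at h
  linear_combination h

theorem IsG4Quaternion.det {ω : ℂ} (h : ω ^ 2 = -ω - 1) {q : Matrix (Fin 2) (Fin 2) ℂ}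
    (hq : IsG4Quaternion ω q) : q.det = 1 := by
  obtain ⟨ε, hε, hq⟩ := hq
  have h2 : ε ^ 2 = 1 := by rcases hε with rfl | rfl <;> norm_num
  rcases hq with rfl | rfl | rfl | rfl <;> simp [Matrix.det_fin_two] <;> grind

/-- The reflection `s` normalizes the quaternion subgroup. -/
theorem IsG4Quaternion.exists_mul_eq {ω : ℂ} (h : ω ^ 2 = -ω - 1)
    {q : Matrix (Fin 2) (Fin 2) ℂ} (hq : IsG4Quaternion ω q) :
    ∃ q', IsG4Quaternion ω q' ∧ !![ω, 0; ω ^ 2, 1] * q = q' * !![ω, 0; ω ^ 2, 1] := by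
  obtain ⟨ε, hε, hq⟩ := hq
  have h3 : ω ^ 3 = 1 := by grind
  refine ⟨!![ω, 0; ω ^ 2, 1] * q * !![ω ^ 2, 0; -ω, 1], ?_, ?_⟩
  · have hε' : -ε = 1 ∨ -ε = -1 := by grind
    rcases hq with rfl | rfl | rfl | rfl
    · refine ⟨ε, hε, Or.inl ?_⟩
      ext i j; fin_cases i <;> fin_cases j <;> simp [Matrix.mul_apply, Fin.sum_univ_two] <;> grind
    · refine ⟨ε, hε, Or.inr (Or.inr (Or.inl ?_))⟩
      ext i j; fin_cases i <;> fin_cases j <;> simp [Matrix.mul_apply, Fin.sum_univ_two] <;> grind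
    · refine ⟨-ε, hε', Or.inr (Or.inr (Or.inr ?_))⟩
      ext i j; fin_cases i <;> fin_cases j <;> simp [Matrix.mul_apply, Fin.sum_univ_two] <;> grind
    · refine ⟨-ε, hε', Or.inr (Or.inl ?_)⟩
      ext i j; fin_cases i <;> fin_cases j <;> simp [Matrix.mul_apply, Fin.sum_univ_two] <;> grind
  · have : !![ω ^ 2, 0; -ω, 1] * !![ω, 0; ω ^ 2, 1] = (1 : Matrix (Fin 2) (Fin 2) ℂ) := by
      ext i j; fin_cases i <;> fin_cases j <;>
        simp [Matrix.mul_apply, Fin.sum_univ_two] <;> grind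
    rw [mul_assoc, this, mul_one]

/-- The quaternion `t * s⁻¹` maps the quaternion subgroup to itself. -/
theorem IsG4Quaternion.mul_left {ω : ℂ} (h : ω ^ 2 = -ω - 1)
    {q : Matrix (Fin 2) (Fin 2) ℂ} (hq : IsG4Quaternion ω q) :
    IsG4Quaternion ω (!![-ω, -ω ^ 2; -ω ^ 2, ω] * q) := by
  obtain ⟨ε, hε, hq⟩ := hq
  have hε' : -ε = 1 ∨ -ε = -1 := by grind
  rcases hq with rfl | rfl | rfl | rfl
  · refine ⟨ε, hε, Or.inr (Or.inl ?_)⟩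
    ext i j; fin_cases i <;> fin_cases j <;> simp [Matrix.mul_apply, Fin.sum_univ_two] <;> grind
  · refine ⟨-ε, hε', Or.inl ?_⟩
    ext i j; fin_cases i <;> fin_cases j <;> simp [Matrix.mul_apply, Fin.sum_univ_two] <;> grind
  · refine ⟨ε, hε, Or.inr (Or.inr (Or.inr ?_))⟩
    ext i j; fin_cases i <;> fin_cases j <;> simp [Matrix.mul_apply, Fin.sum_univ_two] <;> grind
  · refine ⟨-ε, hε', Or.inr (Or.inr (Or.inl ?_))⟩
    ext i j; fin_cases i <;> fin_cases j <;> simp [Matrix.mul_apply, Fin.sum_univ_two] <;> grind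

section Generators

variable {ω : ℂ} {s t : GL (Fin 2) ℂ}

theorem G4_pow_three_left (h : ω ^ 2 = -ω - 1)
    (hs : (s : Matrix (Fin 2) (Fin 2) ℂ) = !![ω, 0; ω ^ 2, 1]) : s ^ 3 = 1 := by
  ext i j
  fin_cases i <;> fin_cases j <;>
    simp [pow_succ, hs, Matrix.mul_apply, Fin.sum_univ_two] <;> grind

theorem G4_pow_three_right (h : ω ^ 2 = -ω - 1)
    (ht : (t : Matrix (Fin 2) (Fin 2) ℂ) = !![1, -ω ^ 2; 0, ω]) : t ^ 3 = 1 := by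
  ext i j
  fin_cases i <;> fin_cases j <;>
    simp [pow_succ, ht, Matrix.mul_apply, Fin.sum_univ_two] <;> grind

theorem G4_braid (h : ω ^ 2 = -ω - 1)
    (hs : (s : Matrix (Fin 2) (Fin 2) ℂ) = !![ω, 0; ω ^ 2, 1])
    (ht : (t : Matrix (Fin 2) (Fin 2) ℂ) = !![1, -ω ^ 2; 0, ω]) :
    s * t * s = t * s * t := by
  ext i j
  fin_cases i <;> fin_cases j <;>
    simp [hs, ht, Matrix.mul_apply, Fin.sum_univ_two] <;> grind

/-- Every element of `G₄` is a quaternion times a power of `s`. -/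
theorem G4_exists_quaternion_mul_pow (h : ω ^ 2 = -ω - 1)
    (hs : (s : Matrix (Fin 2) (Fin 2) ℂ) = !![ω, 0; ω ^ 2, 1])
    (ht : (t : Matrix (Fin 2) (Fin 2) ℂ) = !![1, -ω ^ 2; 0, ω])
    {w : GL (Fin 2) ℂ} (hw : w ∈ Subgroup.closure {s, t}) :
    ∃ q : Matrix (Fin 2) (Fin 2) ℂ, ∃ k : ℕ, IsG4Quaternion ω q ∧
      (w : Matrix (Fin 2) (Fin 2) ℂ) = q * (s : Matrix (Fin 2) (Fin 2) ℂ) ^ k := by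
  have hmul_s : ∀ x : GL (Fin 2) ℂ,
      (∃ q : Matrix (Fin 2) (Fin 2) ℂ, ∃ k : ℕ, IsG4Quaternion ω q ∧
        (x : Matrix (Fin 2) (Fin 2) ℂ) = q * (s : Matrix (Fin 2) (Fin 2) ℂ) ^ k) →
      ∃ q : Matrix (Fin 2) (Fin 2) ℂ, ∃ k : ℕ, IsG4Quaternion ω q ∧
        ((s * x : GL (Fin 2) ℂ) : Matrix (Fin 2) (Fin 2) ℂ) =
          q * (s : Matrix (Fin 2) (Fin 2) ℂ) ^ k := by
    rintro x ⟨q, k, hq, hx⟩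
    obtain ⟨q', hq', hqq⟩ := hq.exists_mul_eq h
    refine ⟨q', k + 1, hq', ?_⟩
    rw [← hs] at hqq
    rw [Units.val_mul, hx, ← mul_assoc, hqq, mul_assoc, ← pow_succ']
  have hts : (t : Matrix (Fin 2) (Fin 2) ℂ) = !![-ω, -ω ^ 2; -ω ^ 2, ω] * s := by
    rw [hs, ht]
    ext i j; fin_cases i <;> fin_cases j <;>
      simp [Matrix.mul_apply, Fin.sum_univ_two] <;> grind
  have hmul_t : ∀ x : GL (Fin 2) ℂ,
      (∃ q : Matrix (Fin 2) (Fin 2) ℂ, ∃ k : ℕ, IsG4Quaternion ω q ∧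
        (x : Matrix (Fin 2) (Fin 2) ℂ) = q * (s : Matrix (Fin 2) (Fin 2) ℂ) ^ k) →
      ∃ q : Matrix (Fin 2) (Fin 2) ℂ, ∃ k : ℕ, IsG4Quaternion ω q ∧
        ((t * x : GL (Fin 2) ℂ) : Matrix (Fin 2) (Fin 2) ℂ) =
          q * (s : Matrix (Fin 2) (Fin 2) ℂ) ^ k := by
    intro x hx
    obtain ⟨q, k, hq, hqx⟩ := hmul_s x hx
    refine ⟨_, k, hq.mul_left h, ?_⟩
    rw [Units.val_mul, hts, mul_assoc, ← Units.val_mul, hqx, mul_assoc]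
  have hs_inv : s⁻¹ = s * s := by
    rw [inv_eq_iff_mul_eq_one, ← G4_pow_three_left h hs, pow_three]
  have ht_inv : t⁻¹ = t * t := by
    rw [inv_eq_iff_mul_eq_one, ← G4_pow_three_right h ht, pow_three]
  induction hw using Subgroup.closure_induction_left with
  | one => exact ⟨1, 0, ⟨1, Or.inl rfl, Or.inl (by simp [Matrix.one_fin_two])⟩, by simp⟩
  | mul_left x hx y _ ih =>
    rcases hx with rfl | rfl
    exacts [hmul_s _ ih, hmul_t _ ih]
  | inv_mul_cancel x hx y _ ih =>
    rcases hx with rfl | rfl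
    · rw [hs_inv, mul_assoc]
      exact hmul_s _ (hmul_s _ ih)
    · rw [ht_inv, mul_assoc]
      exact hmul_t _ (hmul_t _ ih)

/-- The elements of `G₄` with determinant `ω` and trace `1 + ω` are the four reflections
conjugate to `s`. -/
theorem G4_reflection_cases (hω : IsPrimitiveRoot ω 3)
    (hs : (s : Matrix (Fin 2) (Fin 2) ℂ) = !![ω, 0; ω ^ 2, 1])
    (ht : (t : Matrix (Fin 2) (Fin 2) ℂ) = !![1, -ω ^ 2; 0, ω])
    {w : GL (Fin 2) ℂ} (hw : w ∈ Subgroup.closure {s, t})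
    (hdet : (w : Matrix (Fin 2) (Fin 2) ℂ).det = ω)
    (htr : (w : Matrix (Fin 2) (Fin 2) ℂ).trace = 1 + ω) :
    w = s ∨ w = t ∨ w * s = s * t ∨ s * w = t * s := by
  have h := cube_root_sq hω
  obtain ⟨q, k, hq, hwq⟩ := G4_exists_quaternion_mul_pow h hs ht hw
  have hdet_s : (s : Matrix (Fin 2) (Fin 2) ℂ).det = ω := by
    rw [hs]; simp [Matrix.det_fin_two]
  rw [hwq, Matrix.det_mul, hq.det h, Matrix.det_pow, hdet_s, one_mul] at hdet
  have hk : k % 3 = 1 := by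
    have hmod : ω ^ (k % 3) = ω := by
      rwa [← Nat.div_add_mod k 3, pow_add, pow_mul, hω.pow_eq_one, one_pow, one_mul] at hdet
    exact hω.pow_inj (Nat.mod_lt _ (by norm_num)) (by norm_num) (by rw [hmod, pow_one])
  have hsk : (s : Matrix (Fin 2) (Fin 2) ℂ) ^ k = s := by
    have : s ^ k = s := by
      rw [← Nat.div_add_mod k 3, hk, pow_add, pow_mul, G4_pow_three_left h hs, one_pow,
        one_mul, pow_one]
    rw [← Units.val_pow_eq_pow_val, this]
  rw [hsk, hs] at hwq
  have hne : ω ≠ 0 := hω.ne_zero (by norm_num)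
  have hne1 : 1 + ω ≠ 0 := by
    intro h0
    have : ω ^ 2 = 0 := by rw [h]; linear_combination -h0
    exact hne (pow_eq_zero_iff (by norm_num) |>.mp this)
  rw [hwq] at htr
  obtain ⟨ε, hε, hq⟩ := hq
  rcases hε with rfl | rfl <;> rcases hq with rfl | rfl | rfl | rfl <;>
    simp [Matrix.trace_fin_two] at htr <;>
    first
    | (exfalso; grind)
    | (left; ext i j; rw [hwq, hs]; fin_cases i <;> fin_cases j <;>
        simp [Matrix.mul_apply, Fin.sum_univ_two] <;> grind)
    | (right; left; ext i j; rw [hwq, ht]; fin_cases i <;> fin_cases j <;>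
        simp [Matrix.mul_apply, Fin.sum_univ_two] <;> grind)
    | (right; right; left; ext i j; rw [Units.val_mul, Units.val_mul, hwq, hs, ht]
       fin_cases i <;> fin_cases j <;>
        simp [Matrix.mul_apply, Fin.sum_univ_two] <;> grind)
    | (right; right; right; ext i j; rw [Units.val_mul, Units.val_mul, hwq, hs, ht]
       fin_cases i <;> fin_cases j <;>
        simp [Matrix.mul_apply, Fin.sum_univ_two] <;> grind)

/-- A matrix commuting with both generators of `G₄` is scalar. -/
theorem G4_scalar_of_commute (hω : ω ≠ 0)
    (hs : (s : Matrix (Fin 2) (Fin 2) ℂ) = !![ω, 0; ω ^ 2, 1])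
    (ht : (t : Matrix (Fin 2) (Fin 2) ℂ) = !![1, -ω ^ 2; 0, ω])
    {A : Matrix (Fin 2) (Fin 2) ℂ} (hAs : A * s = s * A) (hAt : A * t = t * A) :
    A = A 0 0 • (1 : Matrix (Fin 2) (Fin 2) ℂ) := by
  have hs00 := congrFun (congrFun hAs 0) 0
  have hs10 := congrFun (congrFun hAs 1) 0
  have ht00 := congrFun (congrFun hAt 0) 0
  have ht01 := congrFun (congrFun hAt 0) 1
  simp [hs, ht, Matrix.mul_apply, Fin.sum_univ_two] at hs00 hs10 ht00 ht01
  ext i j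
  fin_cases i <;> fin_cases j <;> simp <;> grind

end Generators


/-- Let `W = ⟨s, t⟩ ⊆ GL₂(ℂ)` be the complex reflection group of type `G₄`, where
`s = [[ω, 0], [ω², 1]]` and `t = [[1, -ω²], [0, ω]]` for a primitive third root of unity
`ω`. Every finite-order element `σ ∈ GL₂(ℂ)` normalizing `W` lies in `ℂ^×·W`: there exist
a root of unity `c` and `w ∈ W` with `σ = c·w`. -/
theorem G4_normalizer_scalar_times_W (ω : ℂ) (hω : IsPrimitiveRoot ω 3)
    (s t : GL (Fin 2) ℂ)
    (hs : (s : Matrix (Fin 2) (Fin 2) ℂ) = !![ω, 0; ω ^ 2, 1])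
    (ht : (t : Matrix (Fin 2) (Fin 2) ℂ) = !![1, -ω ^ 2; 0, ω])
    (σ : GL (Fin 2) ℂ) (hfin : IsOfFinOrder σ)
    (hnorm : (Subgroup.closure {s, t}).map (MulAut.conj σ).toMonoidHom
        = Subgroup.closure {s, t}) :
    ∃ c : ℂ, (∃ N : ℕ, 1 ≤ N ∧ c ^ N = 1) ∧
      ∃ w ∈ Subgroup.closure {s, t},
        (σ : Matrix (Fin 2) (Fin 2) ℂ) = c • (w : Matrix (Fin 2) (Fin 2) ℂ) := by
  have h := cube_root_sq hω
  have hne : ω ≠ 0 := hω.ne_zero (by norm_num)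
  set W := Subgroup.closure {s, t}
  have hsW : s ∈ W := Subgroup.subset_closure (by simp)
  have htW : t ∈ W := Subgroup.subset_closure (by simp)
  have hbraid := G4_braid h hs ht
  have hconj : ∀ x ∈ W, σ * x * σ⁻¹ ∈ W := fun x hx => by
    rw [← hnorm]
    exact ⟨x, hx, rfl⟩
  have hdet_s : (s : Matrix (Fin 2) (Fin 2) ℂ).det = ω := by
    rw [hs]; simp [Matrix.det_fin_two]
  have hdet_t : (t : Matrix (Fin 2) (Fin 2) ℂ).det = ω := by
    rw [ht]; simp [Matrix.det_fin_two]
  have htr_s : (s : Matrix (Fin 2) (Fin 2) ℂ).trace = 1 + ω := by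
    rw [hs]; simp [Matrix.trace_fin_two, add_comm]
  have htr_t : (t : Matrix (Fin 2) (Fin 2) ℂ).trace = 1 + ω := by
    rw [ht]; simp [Matrix.trace_fin_two]
  have hdet_conj : ∀ g x : GL (Fin 2) ℂ,
      ((g * x * g⁻¹ : GL (Fin 2) ℂ) : Matrix (Fin 2) (Fin 2) ℂ).det =
        (x : Matrix (Fin 2) (Fin 2) ℂ).det := fun g x => by
    rw [Units.val_mul, Units.val_mul, Matrix.det_units_conj]
  have htr_conj : ∀ g x : GL (Fin 2) ℂ,
      ((g * x * g⁻¹ : GL (Fin 2) ℂ) : Matrix (Fin 2) (Fin 2) ℂ).trace =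
        (x : Matrix (Fin 2) (Fin 2) ℂ).trace := fun g x => by
    rw [Units.val_mul, Units.val_mul, Matrix.trace_units_conj]
  have hst : (s * t) * s * (s * t)⁻¹ = t := by
    rw [mul_inv_eq_iff_eq_mul, hbraid, mul_assoc]
  obtain ⟨g, hg, hgs⟩ : ∃ g ∈ W, σ * s * σ⁻¹ = g * s * g⁻¹ := by
    rcases G4_reflection_cases hω hs ht (hconj s hsW) ((hdet_conj σ s).trans hdet_s)
      ((htr_conj σ s).trans htr_s) with hx | hx | hx | hx
    · exact ⟨1, W.one_mem, by rw [hx]; group⟩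
    · exact ⟨s * t, W.mul_mem hsW htW, by rw [hx, hst]⟩
    · refine ⟨s * (s * t), W.mul_mem hsW (W.mul_mem hsW htW), ?_⟩
      rw [eq_mul_inv_of_mul_eq hx]
      conv_lhs => rw [← hst]
      group
    · refine ⟨s⁻¹ * (s * t), W.mul_mem (W.inv_mem hsW) (W.mul_mem hsW htW), ?_⟩
      rw [eq_inv_mul_of_mul_eq hx]
      conv_lhs => rw [← hst]
      group
  have hτs : (g⁻¹ * σ) * s * (g⁻¹ * σ)⁻¹ = s := by
    calc (g⁻¹ * σ) * s * (g⁻¹ * σ)⁻¹ = g⁻¹ * (σ * s * σ⁻¹) * g := by group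
      _ = s := by rw [hgs]; group
  have hτW : (g⁻¹ * σ) * t * (g⁻¹ * σ)⁻¹ ∈ W := by
    have : (g⁻¹ * σ) * t * (g⁻¹ * σ)⁻¹ = g⁻¹ * (σ * t * σ⁻¹) * g := by group
    rw [this]
    exact W.mul_mem (W.mul_mem (W.inv_mem hg) (hconj t htW)) hg
  set τ := g⁻¹ * σ with hτ
  obtain ⟨u, hu, hus, hut⟩ : ∃ u ∈ W, u * s * u⁻¹ = s ∧ τ * t * τ⁻¹ = u * t * u⁻¹ := by
    rcases G4_reflection_cases hω hs ht hτW ((hdet_conj τ t).trans hdet_t)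
      ((htr_conj τ t).trans htr_t) with hx | hx | hx | hx
    · have hts : t = s := by
        have : τ * t * τ⁻¹ = τ * s * τ⁻¹ := hx.trans hτs.symm
        exact mul_left_cancel (mul_right_cancel this)
      have h01 := congrArg (fun x : GL (Fin 2) ℂ => (x : Matrix (Fin 2) (Fin 2) ℂ) 0 1) hts
      simp [hs, ht, hne] at h01
    · exact ⟨1, W.one_mem, by group, by rw [hx]; group⟩
    · exact ⟨s, hsW, by group, eq_mul_inv_of_mul_eq hx⟩
    · exact ⟨s⁻¹, W.inv_mem hsW, by group, by rw [eq_inv_mul_of_mul_eq hx]; group⟩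
  have hcomm : ∀ x : GL (Fin 2) ℂ, τ * x * τ⁻¹ = u * x * u⁻¹ →
      ((u⁻¹ * τ : GL (Fin 2) ℂ) : Matrix (Fin 2) (Fin 2) ℂ) * x =
        x * ((u⁻¹ * τ : GL (Fin 2) ℂ) : Matrix (Fin 2) (Fin 2) ℂ) := fun x hx => by
    rw [← Units.val_mul, ← Units.val_mul]
    congr 1
    calc u⁻¹ * τ * x = u⁻¹ * (τ * x * τ⁻¹) * τ := by group
      _ = x * (u⁻¹ * τ) := by rw [hx]; group
  have hscalar := G4_scalar_of_commute hne hs ht (hcomm s (hτs.trans hus.symm)) (hcomm t hut)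
  set c := ((u⁻¹ * τ : GL (Fin 2) ℂ) : Matrix (Fin 2) (Fin 2) ℂ) 0 0
  have hσ : (σ : Matrix (Fin 2) (Fin 2) ℂ) =
      c • ((g * u : GL (Fin 2) ℂ) : Matrix (Fin 2) (Fin 2) ℂ) := by
    have : σ = (g * u) * (u⁻¹ * τ) := by rw [hτ]; group
    conv_lhs => rw [this, Units.val_mul, hscalar]
    simp
  refine ⟨c, ?_, g * u, W.mul_mem hg hu, hσ⟩
  obtain ⟨n, hn, hσn⟩ := isOfFinOrder_iff_pow_eq_one.mp hfin
  obtain ⟨q, k, hq, hw⟩ := G4_exists_quaternion_mul_pow h hs ht (W.mul_mem hg hu)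
  have hdet : (σ : Matrix (Fin 2) (Fin 2) ℂ).det = c ^ 2 * ω ^ k := by
    rw [hσ, hw, Matrix.det_smul, Matrix.det_mul, hq.det h, Matrix.det_pow, hdet_s]
    simp
  have hdet_pow : (σ : Matrix (Fin 2) (Fin 2) ℂ).det ^ n = 1 := by
    simpa using congrArg (fun x : GL (Fin 2) ℂ => (x : Matrix (Fin 2) (Fin 2) ℂ).det) hσn
  refine ⟨2 * n * 3, by omega, ?_⟩
  calc c ^ (2 * n * 3) = c ^ (2 * n * 3) * (ω ^ 3) ^ (k * n) := by
        rw [hω.pow_eq_one, one_pow, mul_one]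
    _ = ((c ^ 2 * ω ^ k) ^ n) ^ 3 := by ring
    _ = 1 := by rw [← hdet, hdet_pow, one_pow]
end
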